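/- arXiv:1201.1089 — 3 statements merged into one kernel-verified Lean document; each statement's English description precedes it below -/
import Mathlib

section
/- Fix α ∈ (0,1] and p ≥ 2 and let U be the Burkholder-type special function. Then for all x, y, z with x ≥ 0, z > 0 and |y| ≤ z, one has U_x(x,y,z) ≤ −α·|U_y(x,y,z)| (for x = 0, U_x denotes the right-sided derivative). -/
open Set Filter Topology

lemma aux_gamma {α p : ℝ} (hα0 : 0 < α) (hp : 2 ≤ p) {γ : ℝ → ℝ}
    (hγlin : ∀ x : ℝ, 0 ≤ x → x < ((α+1)*p)⁻¹ → γ x = ((p-1)*(α+1)-1)*x + 1/p)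
    (hγode : ∀ x : ℝ, ((α+1)*p)⁻¹ < x →
      HasDerivAt γ
        ((-1 + ((α+1)*p)^p * (p-1) * (1 - γ x) * γ x * x^(p-2)) /
          (1 + ((α+1)*p)^p * (p-1) * (1 - γ x) * x^(p-1))) x)
    (hγinit : γ (((α+1)*p)⁻¹) = 1 - ((α+1)*p)⁻¹)
    (hγdiff : DifferentiableOn ℝ γ (Set.Ici (0:ℝ)))
    (hγmono : MonotoneOn γ (Set.Ici (0:ℝ)))
    (hγlt : ∀ x : ℝ, 0 ≤ x → γ x < 1) (g : ℝ) (hg : 0 < g) :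
    ∃ d, HasDerivAt γ d g ∧ 0 < 1 + d ∧
      ∀ x, 0 ≤ x → g + γ g - x ≤ 1 → (1+α)*(p-1)*(g-x) ≤ g*(1+d) := by
  have hK : 0 < (α+1)*p := by positivity
  have hp1 : 0 < p - 1 := by linarith
  have hx0 : 0 < ((α+1)*p)⁻¹ := inv_pos.mpr hK
  have hlinx0 : ((p-1)*(α+1)-1)*((α+1)*p)⁻¹ + 1/p = 1 - ((α+1)*p)⁻¹ := by
    field_simp
    ring
  have hle : ∀ x, 0 ≤ x → x ≤ ((α+1)*p)⁻¹ → γ x = ((p-1)*(α+1)-1)*x + 1/p := by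
    intro x h0 h1
    rcases h1.lt_or_eq with h1 | h1
    · exact hγlin x h0 h1
    · rw [h1, hγinit, hlinx0]
  by_cases hc : g ≤ ((α+1)*p)⁻¹
  · have hd : HasDerivAt γ (deriv γ g) g :=
      ((hγdiff g hg.le).differentiableAt (Ici_mem_nhds hg)).hasDerivAt
    have hd2 : HasDerivWithinAt γ ((p-1)*(α+1)-1) (Icc 0 g) g := by
      have h1 : HasDerivAt (fun x : ℝ => ((p-1)*(α+1)-1)*x + 1/p) (((p-1)*(α+1)-1)*1) g :=
        ((hasDerivAt_id g).const_mul _).add_const _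
      rw [mul_one] at h1
      refine h1.hasDerivWithinAt.congr (fun x hx => hle x hx.1 (hx.2.trans hc)) (hle g hg.le hc)
    have heq : deriv γ g = (p-1)*(α+1)-1 :=
      (uniqueDiffOn_Icc hg g ⟨hg.le, le_rfl⟩).eq_deriv _ hd.hasDerivWithinAt hd2
    rw [heq] at hd
    refine ⟨_, hd, ?_, ?_⟩
    · have : 0 < (p-1)*(α+1) := by positivity
      linarith
    · intro x hx _
      have : 0 < (p-1)*(α+1) := by positivity
      nlinarith [mul_nonneg this.le hx]
  · push Not at hc
    have hd := hγode g hc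
    have hlt := hγlt g hg.le
    have hmon : 1 - ((α+1)*p)⁻¹ ≤ γ g := by
      rw [← hγinit]; exact hγmono hx0.le hg.le hc.le
    have hinv1 : ((α+1)*p)⁻¹ ≤ 1/2 := by
      rw [inv_le_comm₀ hK (by norm_num)]
      nlinarith
    have hγpos : 0 < γ g := by linarith
    have hKp : 0 < ((α+1)*p)^p := Real.rpow_pos_of_pos hK _
    have hq : 0 < g^(p-2) := Real.rpow_pos_of_pos hg _
    have hqg : g^(p-1) = g^(p-2)*g := by
      rw [← Real.rpow_add_one hg.ne']; congr 1; ring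
    -- lower bound for C g^(p-1)
    have hbig : ((α+1)*p)*(p-1) ≤ ((α+1)*p)^p * (p-1) * g^(p-1) := by
      have h1 : (((α+1)*p)⁻¹)^(p-1) ≤ g^(p-1) := Real.rpow_le_rpow hx0.le hc.le hp1.le
      have h2 : ((α+1)*p)^p * (((α+1)*p)⁻¹)^(p-1) = (α+1)*p := by
        rw [Real.inv_rpow hK.le, Real.rpow_sub_one hK.ne']
        field_simp
      calc ((α+1)*p)*(p-1) = (((α+1)*p)^p * (((α+1)*p)⁻¹)^(p-1)) * (p-1) := by rw [h2]
        _ ≤ (((α+1)*p)^p * g^(p-1)) * (p-1) := by gcongr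
        _ = _ := by ring
    have hbr : 1/p ≤ γ g + g - (1+α)*(p-1)*(1-γ g) := by
      have h1 : (1+α)*(p-1)*(1-γ g) ≤ (1+α)*(p-1)*((α+1)*p)⁻¹ := by
        apply mul_le_mul_of_nonneg_left (by linarith) (by positivity)
      have h2 : (1+α)*(p-1)*((α+1)*p)⁻¹ = 1 - 1/p := by field_simp; ring
      linarith
    have hfin : (1+α)*(p-1) ≤ ((α+1)*p)^p * (p-1) * g^(p-1) *
        (γ g + g - (1+α)*(p-1)*(1-γ g)) := by
      calc (1+α)*(p-1) = ((α+1)*p)*(p-1) * (1/p) := by field_simp; ring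
        _ ≤ _ := by gcongr
    rw [hqg] at hfin hd
    generalize ((α+1)*p)^p = Q at *
    generalize g^(p-2) = q at *
    have hC : 0 < Q*(p-1) := by positivity
    have h1γ : 0 < 1 - γ g := by linarith
    have hden : 0 < 1 + Q * (p-1) * (1 - γ g) * (q*g) := by positivity
    have h1d : 1 + (-1 + Q * (p-1) * (1 - γ g) * γ g * q) / (1 + Q * (p-1) * (1 - γ g) * (q*g))
        = (Q * (p-1) * (1 - γ g) * q * (γ g + g)) / (1 + Q * (p-1) * (1 - γ g) * (q*g)) := by
      rw [eq_div_iff hden.ne', add_mul, div_mul_cancel₀ _ hden.ne']; ring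
    refine ⟨_, hd, ?_, ?_⟩
    · rw [h1d]; positivity
    · intro x hx hxs
      rw [h1d]
      have h3 : (1+α)*(p-1)*(g-x) ≤ (1+α)*(p-1)*(1-γ g) := by
        apply mul_le_mul_of_nonneg_left (by linarith) (by positivity)
      refine h3.trans ?_
      rw [← mul_div_assoc, le_div_iff₀ hden]
      nlinarith [mul_le_mul_of_nonneg_left hfin h1γ.le]

/-- transfer of a one-sided derivative: the two-sided derivative is either it or zero -/
lemma aux_deriv {f : ℝ → ℝ} {s : Set ℝ} {d y : ℝ} (hs : UniqueDiffWithinAt ℝ s y)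
    (h : HasDerivWithinAt f d s y) : |deriv f y| ≤ |d| := by
  by_cases hf : DifferentiableAt ℝ f y
  · rw [hs.eq_deriv _ hf.hasDerivAt.hasDerivWithinAt h]
  · rw [deriv_zero_of_not_differentiableAt hf]; simp

/-- Derivative inequality for the Burkholder-type special function:
`Uₓ(x,y,z) ≤ -α |U_y(x,y,z)|` for `x ≥ 0`, `z > 0`, `|y| ≤ z` (with the
right-sided derivative in the first variable at `x = 0`). -/
theorem special_function_derivative_inequality
    {α p : ℝ} (hα0 : 0 < α) (hα1 : α ≤ 1) (hp : 2 ≤ p)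
    {γ h : ℝ → ℝ} {u : ℝ → ℝ → ℝ} {U : ℝ → ℝ → ℝ → ℝ}
    (hγlin : ∀ x : ℝ, 0 ≤ x → x < ((α+1)*p)⁻¹ → γ x = ((p-1)*(α+1)-1)*x + 1/p)
    (hγode : ∀ x : ℝ, ((α+1)*p)⁻¹ < x →
      HasDerivAt γ
        ((-1 + ((α+1)*p)^p * (p-1) * (1 - γ x) * γ x * x^(p-2)) /
          (1 + ((α+1)*p)^p * (p-1) * (1 - γ x) * x^(p-1))) x)
    (hγinit : γ (((α+1)*p)⁻¹) = 1 - ((α+1)*p)⁻¹)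
    (hγdiff : DifferentiableOn ℝ γ (Set.Ici (0:ℝ)))
    (hγmono : MonotoneOn γ (Set.Ici (0:ℝ)))
    (hγconc : ConcaveOn ℝ (Set.Ici (0:ℝ)) γ)
    (hγlt : ∀ x : ℝ, 0 ≤ x → γ x < 1)
    (hh1 : ∀ x : ℝ, ((α+1)*p)⁻¹ ≤ x → h (x + γ x) = x)
    (hh2 : ∀ y : ℝ, 1 ≤ y → h y + γ (h y) = y)
    (hh3 : ∀ y : ℝ, 1 ≤ y → ((α+1)*p)⁻¹ ≤ h y)
    (hu0 : ∀ x y : ℝ, 0 ≤ x → |y| ≤ 1 → |y| ≤ γ x →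
      u x y = 1 - ((α+1)*p)^p * x^p)
    (hu1 : ∀ x y : ℝ, 0 ≤ x → |y| ≤ 1 → γ x < |y| → x + |y| ≤ 1 →
      u x y = 1 - ((p*x + p*|y| - 1)/(p-1))^(p-1) * (p*(p*(α+1)-1)*x - p*|y| + 1))
    (hu2 : ∀ x y : ℝ, 0 ≤ x → |y| ≤ 1 → γ x < |y| → 1 < x + |y| →
      u x y = 1 - ((α+1)*p)^p * (h (x+|y|))^(p-1) * (p*x - (p-1) * h (x+|y|)))
    (hU : ∀ x y z : ℝ, 0 ≤ x → 0 < z →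
      U x y z = (max |y| z)^p * u (x / max |y| z) (y / max |y| z))
    :
    ∀ x y z : ℝ, 0 ≤ x → 0 < z → |y| ≤ z →
      derivWithin (fun t => U t y z) (Set.Ici (0:ℝ)) x
        ≤ -α * |deriv (fun t => U x t z) y| := by
  have hK : 0 < (α+1)*p := by positivity
  have hp0 : 0 < p := by linarith
  have hp1 : 0 < p - 1 := by linarith
  have hx0 : 0 < ((α+1)*p)⁻¹ := inv_pos.mpr hK
  have hKp : 0 < ((α+1)*p)^p := Real.rpow_pos_of_pos hK _
  have hγ0 : γ 0 = 1/p := by rw [hγlin 0 le_rfl hx0]; ring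
  have hγpos : ∀ x, 0 ≤ x → 1/p ≤ γ x := fun x hx => by
    rw [← hγ0]; exact hγmono (mem_Ici.2 le_rfl) hx hx
  have hppos : 0 < 1/p := by positivity
  -- the inverse function, extended
  obtain ⟨k, hkdef⟩ : ∃ k : ℝ → ℝ, k = fun s => if s ≤ 1 then (p*s-1)/((p-1)*((α+1)*p)) else h s :=
    ⟨_, rfl⟩
  have hklin : ∀ s, s ≤ 1 → k s = (p*s-1)/((p-1)*((α+1)*p)) := fun s hs => by simp [hkdef, hs]
  have hkh : ∀ s, 1 < s → k s = h s := fun s hs => by simp [hkdef, not_le.2 hs]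
  have hk0 : ∀ s, 1/p ≤ s → 0 ≤ k s := by
    intro s hs
    by_cases h1 : s ≤ 1
    · rw [hklin s h1]
      rw [div_le_iff₀ hp0] at hs
      apply div_nonneg (by linarith) (by positivity)
    · push Not at h1
      rw [hkh s h1]; exact hx0.le.trans (hh3 s h1.le)
  have hkinv : ∀ s, 1/p ≤ s → k s + γ (k s) = s := by
    intro s hs
    have hk := hk0 s hs
    by_cases h1 : s ≤ 1
    · have hle : k s ≤ ((α+1)*p)⁻¹ := by
        rw [hklin s h1, div_le_iff₀ (by positivity)]
        have : ((α+1)*p)⁻¹ * ((p-1)*((α+1)*p)) = p - 1 := by field_simp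
        rw [this]; nlinarith
      rcases hle.lt_or_eq with h2 | h2
      · rw [hγlin _ hk h2, hklin s h1]
        field_simp
        ring
      · rw [h2, hγinit]
        have h3 := hklin s h1
        rw [h2, eq_div_iff (by positivity)] at h3
        have : ((α+1)*p)⁻¹ * ((p-1)*((α+1)*p)) = p - 1 := by field_simp
        rw [this] at h3
        have : p*(s-1) = 0 := by linarith
        rcases mul_eq_zero.1 this with h | h <;> linarith
    · push Not at h1
      rw [hkh s h1]; exact hh2 s h1.le
  have hklip : ∀ s t, 1/p ≤ s → 1/p ≤ t → s ≤ t → k s ≤ k t ∧ k t - k s ≤ t - s := by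
    intro s t hs ht hst
    have e1 := hkinv s hs
    have e2 := hkinv t ht
    have hle : k s ≤ k t := by
      by_contra hlt
      push Not at hlt
      have := hγmono (hk0 t ht) (hk0 s hs) hlt.le
      linarith
    have := hγmono (hk0 s hs) (hk0 t ht) hle
    exact ⟨hle, by linarith⟩
  have hkcont : ∀ s, 1/p < s → ContinuousAt k s := by
    intro s hs
    rw [ContinuousAt, tendsto_iff_dist_tendsto_zero]
    have h0 : Tendsto (fun t : ℝ => dist t s) (𝓝 s) (𝓝 0) :=
      tendsto_iff_dist_tendsto_zero.1 tendsto_id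
    refine squeeze_zero' (Eventually.of_forall fun t => dist_nonneg) ?_ h0
    filter_upwards [Ioi_mem_nhds hs] with t ht
    have ht' : 1/p ≤ t := le_of_lt ht
    rw [Real.dist_eq, Real.dist_eq]
    rcases le_total s t with hst | hst
    · obtain ⟨a, b⟩ := hklip s t hs.le ht' hst
      rw [abs_of_nonneg (by linarith), abs_of_nonneg (by linarith)]; exact b
    · obtain ⟨a, b⟩ := hklip t s ht' hs.le hst
      rw [abs_of_nonpos (by linarith), abs_of_nonpos (by linarith)]; linarith
  have hkpos : ∀ s, 1/p < s → 0 < k s := by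
    intro s hs
    refine lt_of_le_of_ne (hk0 s hs.le) fun h0 => ?_
    have := hkinv s hs.le
    rw [← h0, hγ0] at this
    linarith
  -- unified formula
  have hform : ∀ x y, 0 ≤ x → |y| ≤ 1 → γ x < |y| →
      u x y = 1 - ((α+1)*p)^p * (k (x+|y|))^(p-1) * (p*x - (p-1) * k (x+|y|)) := by
    intro x y hx hy hxy
    by_cases h1 : x + |y| ≤ 1
    · rw [hu1 x y hx hy hxy h1]
      have hs : 1/p ≤ x + |y| := by linarith [hγpos x hx]
      have hk := hk0 _ hs
      have hA : (p*x + p*|y| - 1)/(p-1) = ((α+1)*p) * k (x+|y|) := by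
        rw [hklin _ h1]; field_simp
        
      have hB : p*x+p*|y| - 1 = (p-1) * (((α+1)*p) * k (x+|y|)) := by
        rw [← hA]; field_simp
      have hC : p*(p*(α+1)-1)*x - p*|y| + 1
          = ((α+1)*p) * (p*x - (p-1) * k (x+|y|)) := by linarith
      rw [hA, hC, Real.mul_rpow hK.le hk, Real.rpow_sub_one hK.ne']
      field_simp
    · push Not at h1
      rw [hu2 x y hx hy hxy h1, hkh _ h1]
  intro x y z hx hz hyz
  have hUz : ∀ t w, 0 ≤ t → |w| ≤ z → U t w z = z^p * u (t/z) (w/z) := by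
    intro t w ht hw
    rw [hU t w z ht hz, max_eq_right hw]
  have hdz : ∀ t : ℝ, HasDerivAt (fun t : ℝ => t/z) (1/z) t := fun t => (hasDerivAt_id t).div_const z
  have hzp : 0 < z^p := Real.rpow_pos_of_pos hz _
  obtain ⟨a, ha⟩ : ∃ a, a = x/z := ⟨_, rfl⟩
  obtain ⟨b, hb⟩ : ∃ b, b = y/z := ⟨_, rfl⟩
  have ha0 : 0 ≤ a := by rw [ha]; positivity
  have hb1 : |b| ≤ 1 := by rw [hb, abs_div, abs_of_pos hz, div_le_one hz]; exact hyz
  have habs : ∀ t : ℝ, |t/z| = |t|/z := fun t => by rw [abs_div, abs_of_pos hz]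
  by_cases hD : |b| ≤ γ a
  · -- region D0
    have hγa : 0 < γ a := lt_of_lt_of_le hppos (hγpos a ha0)
    have hγa1 := hγlt a ha0
    have hzγ : 0 < z * γ a := by positivity
    have hyr : |y| ≤ z * γ a := by
      rw [hb, habs, div_le_iff₀ hz] at hD; linarith
    have hy0 : HasDerivWithinAt (fun t => U x t z) 0 (Icc (-(z*γ a)) (z*γ a)) y := by
      refine (hasDerivWithinAt_const y _ (z^p * (1 - ((α+1)*p)^p * a^p))).congr_of_mem ?_
        (abs_le.1 hyr)
      intro t ht
      have ht1 : |t| ≤ z * γ a := abs_le.2 ht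
      have ht2 : |t| ≤ z := by nlinarith
      have ht3 : |t/z| ≤ γ a := by rw [habs, div_le_iff₀ hz]; linarith
      rw [hUz x t hx ht2, ← ha, hu0 a (t/z) ha0 (by linarith) ht3]
    have hdy := aux_deriv (uniqueDiffOn_Icc (by linarith) y (abs_le.1 hyr)) hy0
    have hdy0 : deriv (fun t => U x t z) y = 0 := by simpa using hdy
    rw [hdy0]
    simp only [abs_zero, mul_zero]
    by_cases hdx : DifferentiableWithinAt ℝ (fun t => U t y z) (Ici 0) x
    · have h1 := hdx.hasDerivWithinAt.mono (Ici_subset_Ici.2 hx)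
      have h2 : HasDerivWithinAt (fun t => U t y z)
          (z^p * -(((α+1)*p)^p * ((1/z) * p * (x/z)^(p-1)))) (Ici x) x := by
        have h3 := ((((hdz x).rpow_const (p := p) (Or.inr (by linarith))).const_mul
          (((α+1)*p)^p)).const_sub 1).const_mul (z^p)
        refine h3.hasDerivWithinAt.congr_of_mem ?_ (mem_Ici.2 le_rfl)
        intro t ht
        have ht : x ≤ t := ht
        have hat : a ≤ t/z := by rw [ha]; gcongr
        rw [hUz t y (hx.trans ht) hyz, ← hb,
          hu0 (t/z) b (ha0.trans hat) hb1 (hD.trans (hγmono ha0 (ha0.trans hat) hat))]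
      rw [(uniqueDiffOn_Ici x x (mem_Ici.2 le_rfl)).eq_deriv _ h1 h2]
      have : 0 ≤ (x/z)^(p-1) := Real.rpow_nonneg (by positivity) _
      rw [mul_neg]
      apply neg_nonpos_of_nonneg
      positivity
    · rw [derivWithin_zero_of_not_differentiableWithinAt hdx]
  · -- region D1 ∪ D2
    push Not at hD
    have hbpos : 0 < |b| := by linarith [hγpos a ha0]
    have hs : 1/p < a + |b| := by linarith [hγpos a ha0]
    have hg := hkpos _ hs
    have hginv := hkinv _ hs.le
    have hag : a ≤ k (a+|b|) := by
      by_contra hlt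
      push Not at hlt
      have := hγmono hg.le ha0 hlt.le
      linarith
    obtain ⟨d, hd, h1d, hineq⟩ := aux_gamma hα0 hp hγlin hγode hγinit hγdiff hγmono hγlt _ hg
    have hin := hineq a ha0 (by linarith)
    have hkd : HasDerivAt k (1+d)⁻¹ (a+|b|) := by
      refine HasDerivAt.of_local_left_inverse (f := fun x => x + γ x) (hkcont _ hs)
        ((hasDerivAt_id _).add hd) h1d.ne' ?_
      filter_upwards [Ioi_mem_nhds hs] with t ht
      exact hkinv t (le_of_lt ht)
    obtain ⟨m, hm⟩ : ∃ m, m = (1+d)⁻¹ := ⟨_, rfl⟩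
    have hmpos : 0 < m := by rw [hm]; positivity
    have hmd : (1+d) * m = 1 := by rw [hm]; field_simp
    rw [← hm] at hkd
    obtain ⟨g, hgdef⟩ : ∃ g, g = k (a+|b|) := ⟨_, rfl⟩
    obtain ⟨q, hq⟩ : ∃ q, q = g^(p-1-1) := ⟨_, rfl⟩
    have hg' : 0 < g := by rw [hgdef]; exact hg
    have hqpos : 0 < q := by rw [hq]; exact Real.rpow_pos_of_pos hg' _
    have hqg : g^(p-1) = q*g := by
      rw [hq, ← Real.rpow_add_one hg'.ne']; congr 1; ring
    -- x-derivative of u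
    have hux : HasDerivWithinAt (fun t => u t b)
        (-(((α+1)*p)^p * q * p * (g - m*(p-1)*(g-a)))) (Ici 0) a := by
      have hk1 : HasDerivAt (fun t => k (t + |b|)) m a := by
        simpa using HasDerivAt.comp_add_const a (|b|) hkd
      have h2 := (((hk1.rpow_const (p := p-1) (Or.inl hg.ne')).const_mul (((α+1)*p)^p)).mul
        (((hasDerivAt_id a).const_mul p).sub (hk1.const_mul (p-1)))).const_sub 1
      have h3 := h2.hasDerivWithinAt (s := Ici 0)
      have hev : ∀ᶠ t in 𝓝[Ici 0] a, γ t < |b| :=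
        (hγdiff a ha0).continuousWithinAt.eventually_lt_const hD
      refine (h3.congr_of_eventuallyEq_of_mem (f₁ := fun t => u t b) ?_ ha0).congr_deriv ?_
      · filter_upwards [hev, self_mem_nhdsWithin] with t ht ht0
        exact hform t b ht0 hb1 ht
      · simp only [id, Pi.sub_apply, ← hgdef, ← hq, hqg]
        ring
    obtain ⟨σ, hσ, hσ1⟩ : ∃ σ : ℝ, HasDerivAt (fun t : ℝ => |t|) σ b ∧ |σ| = 1 := by
      rcases lt_or_gt_of_ne (abs_pos.1 hbpos) with hb0 | hb0
      · exact ⟨-1, hasDerivAt_abs_neg hb0, by simp⟩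
      · exact ⟨1, hasDerivAt_abs_pos hb0, by simp⟩
    have huy : HasDerivWithinAt (fun t => u a t)
        (((α+1)*p)^p * q * p * (m*(p-1)*(g-a)) * σ) (Icc (-1) 1) b := by
      have hk1 : HasDerivAt (fun t => k (a + |t|)) (m*σ) b :=
        HasDerivAt.comp b (h₂ := k) (h := fun t => a + |t|) hkd (hσ.const_add a)
      have h2 := (((hk1.rpow_const (p := p-1) (Or.inl hg.ne')).const_mul (((α+1)*p)^p)).mul
        ((hk1.const_mul (p-1)).const_sub (p*a))).const_sub 1
      have h3 := h2.hasDerivWithinAt (s := Icc (-1) 1)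
      have hev : ∀ᶠ t in 𝓝[Icc (-1) 1] b, γ a < |t| :=
        (continuous_abs.continuousAt.eventually_const_lt hD).filter_mono nhdsWithin_le_nhds
      refine (h3.congr_of_eventuallyEq_of_mem (f₁ := fun t => u a t) ?_ (abs_le.1 hb1)).congr_deriv ?_
      · filter_upwards [hev, self_mem_nhdsWithin] with t ht ht0
        exact hform a t ha0 (abs_le.2 ht0) ht
      · simp only [← hgdef, ← hq, hqg]
        ring
    rw [← hgdef] at hin hag
    have hUx : HasDerivWithinAt (fun t => U t y z)
        (z^p * (-(((α+1)*p)^p * q * p * (g - m*(p-1)*(g-a))) * (1/z))) (Ici 0) x := by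
      have h1 := HasDerivWithinAt.comp x (h₂ := fun t => u t b) (h := fun t => t/z)
        (s := Ici 0) (s' := Ici 0) (by rw [← ha]; exact hux) (hdz x).hasDerivWithinAt
        (fun t ht => div_nonneg ht hz.le)
      refine (h1.const_mul (z^p)).congr_of_mem ?_ hx
      intro t ht
      rw [hUz t y ht hyz, hb]; rfl
    have hUy : HasDerivWithinAt (fun t => U x t z)
        (z^p * ((((α+1)*p)^p * q * p * (m*(p-1)*(g-a)) * σ) * (1/z))) (Icc (-z) z) y := by
      have h1 := HasDerivWithinAt.comp y (h₂ := fun t => u a t) (h := fun t => t/z)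
        (s := Icc (-z) z) (s' := Icc (-1) 1) (by rw [← hb]; exact huy) (hdz y).hasDerivWithinAt
        (fun t ht => by
          rw [mem_Icc, ← abs_le, habs, div_le_one hz]; exact abs_le.2 ht)
      refine (h1.const_mul (z^p)).congr_of_mem ?_ (abs_le.1 hyz)
      intro t ht
      rw [hUz x t hx (abs_le.2 ht), ha]; rfl
    have hdy := aux_deriv (uniqueDiffOn_Icc (by linarith) y (abs_le.1 hyz)) hUy
    rw [hUx.derivWithin (uniqueDiffOn_Ici 0 x hx)]
    obtain ⟨E, hE⟩ : ∃ E, E = z^p * (1/z) * (((α+1)*p)^p * q * p) := ⟨_, rfl⟩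
    have hEpos : 0 < E := by rw [hE]; positivity
    obtain ⟨G, hG⟩ : ∃ G, G = m*(p-1)*(g-a) := ⟨_, rfl⟩
    have hGpos : 0 ≤ G := by
      rw [hG]; exact mul_nonneg (by positivity) (by linarith)
    have hGg : (1+α)*G ≤ g := by
      have := mul_le_mul_of_nonneg_right hin hmpos.le
      rw [mul_assoc g, hmd] at this
      rw [hG]; linarith
    have e1 : z^p * (-(((α+1)*p)^p * q * p * (g - m*(p-1)*(g-a))) * (1/z)) = -(E*(g-G)) := by
      rw [hE, hG]; ring
    have e2 : z^p * ((((α+1)*p)^p * q * p * (m*(p-1)*(g-a)) * σ) * (1/z)) = E*G*σ := by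
      rw [hE, hG]; ring
    rw [e2, abs_mul, hσ1, mul_one, abs_of_nonneg (mul_nonneg hEpos.le hGpos)] at hdy
    rw [e1]
    have hA := mul_le_mul_of_nonneg_left hdy hα0.le
    have hB := mul_le_mul_of_nonneg_left hGg hEpos.le
    linarith
end

section
/- Fix α ∈ (0,1] and p ≥ 2, let γ be the special ODE solution and let h be the inverse of H(x) = x + γ(x). Then for every s > 1 one has h'(s)·(h(s) + (p−2)·(h(s) + 1 − s)) ≤ h(s). -/
/-- The inequality `h'(s)(h(s) + (p-2)(h(s)+1-s)) ≤ h(s)` for `s > 1`, where `h` is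
the inverse of `H(x) = x + γ(x)` and `γ` is the special ODE solution. -/
theorem inverse_of_H_key_inequality
    {α p : ℝ} (hα0 : 0 < α) (hα1 : α ≤ 1) (hp : 2 ≤ p) {γ h : ℝ → ℝ}
    (hγdiff : DifferentiableOn ℝ γ (Set.Ici (((α+1)*p)⁻¹)))
    (hγode : ∀ x : ℝ, ((α+1)*p)⁻¹ < x →
      HasDerivAt γ
        ((-1 + ((α+1)*p)^p * (p-1) * (1 - γ x) * γ x * x^(p-2)) /
          (1 + ((α+1)*p)^p * (p-1) * (1 - γ x) * x^(p-1))) x)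
    (hγinit : γ (((α+1)*p)⁻¹) = 1 - ((α+1)*p)⁻¹)
    (hγmono : MonotoneOn γ (Set.Ici (((α+1)*p)⁻¹)))
    (hγconc : ConcaveOn ℝ (Set.Ici (((α+1)*p)⁻¹)) γ)
    (hγlt : ∀ x : ℝ, ((α+1)*p)⁻¹ ≤ x → γ x < 1)
    (hh1 : ∀ x : ℝ, ((α+1)*p)⁻¹ ≤ x → h (x + γ x) = x)
    (hh2 : ∀ y : ℝ, 1 ≤ y → h y + γ (h y) = y)
    (hh3 : ∀ y : ℝ, 1 ≤ y → ((α+1)*p)⁻¹ ≤ h y) :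
    ∀ s : ℝ, 1 < s →
      deriv h s * (h s + (p-2) * (h s + 1 - s)) ≤ h s := by
  have hq : p < (α+1)*p := by nlinarith
  have hq0 : 0 < (α+1)*p := by linarith
  set q := (α+1)*p with hqdef
  clear_value q
  set a := q⁻¹ with ha
  have ha0 : 0 < a := inv_pos.mpr hq0
  have hqa : q * a = 1 := mul_inv_cancel₀ hq0.ne'
  have hC : 0 < q^p * (p-1) := mul_pos (Real.rpow_pos_of_pos hq0 p) (by linarith)
  have hCa : q^p * (p-1) * a^(p-2) = q^2 * (p-1) := by
    have h1 : q^p * a^(p-2) = q^2 := by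
      rw [ha, Real.inv_rpow hq0.le, ← Real.rpow_neg hq0.le, ← Real.rpow_add hq0]
      have : p + -(p-2) = ((2:ℕ):ℝ) := by push_cast; ring
      rw [this, Real.rpow_natCast]
    calc _ = q^p * a^(p-2) * (p-1) := by ring
      _ = _ := by rw [h1]
  set C := q^p * (p-1) with hCdef
  clear_value C a
  have hpow : ∀ x : ℝ, 0 < x → x^(p-1) = x^(p-2) * x := by
    intro x hx
    have : p - 1 = (p-2) + 1 := by ring
    rw [this, Real.rpow_add hx, Real.rpow_one]
  have hder0 : ∀ x d : ℝ, a < x → HasDerivAt γ d x → 0 ≤ d := by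
    intro x d hx hd
    have h1 := (hd.hasDerivWithinAt (s := Set.Ici a)).derivWithin (uniqueDiffOn_Ici a x hx.le)
    rw [← h1]
    exact hγmono.derivWithin_nonneg
  -- main claim
  have key : ∀ x d : ℝ, a < x → HasDerivAt γ d x → (p-2) * (1 - γ x) ≤ x * d := by
    intro x d hx hd
    rcases hp.eq_or_lt with hp2 | hp2
    · have := hder0 x d hx hd
      rw [← hp2]
      have : 0 ≤ x * d := mul_nonneg (by linarith) this
      linarith
    -- relation of K with the derivative
    have rel : ∀ x d : ℝ, a < x → HasDerivAt γ d x →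
        (1 + (p-2) * (1 - γ x) / x + C * (x^(p-2) * (1 - γ x)) * ((p-1) * (1 - γ x) - 1)) * x
          = ((p-2) * (1 - γ x) - x * d) * (1 + C * (1 - γ x) * (x^(p-2) * x))
        ∧ 0 < 1 + C * (1 - γ x) * (x^(p-2) * x) := by
      intro x d hx hd
      have hx0 : 0 < x := ha0.trans hx
      have hy : 0 < x^(p-2) := Real.rpow_pos_of_pos hx0 _
      have hg : 0 < 1 - γ x := by linarith [hγlt x hx.le]
      have hD : 0 < 1 + C * (1 - γ x) * (x^(p-2) * x) := by positivity
      refine ⟨?_, hD⟩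
      have e := hd.unique (hγode x hx)
      rw [hpow x hx0, eq_div_iff hD.ne'] at e
      have e2 : ((p-2) * (1 - γ x) - x * d) * (1 + C * (1 - γ x) * (x^(p-2) * x))
        = (p-2) * (1 - γ x) * (1 + C * (1 - γ x) * (x^(p-2) * x)) -
          x * (d * (1 + C * (1 - γ x) * (x^(p-2) * x))) := by ring
      rw [e2, e]
      field_simp
      ring
    let K : ℝ → ℝ := fun x =>
      1 + (p-2) * (1 - γ x) / x + C * (x^(p-2) * (1 - γ x)) * ((p-1) * (1 - γ x) - 1)
    have hKa : K a < 0 := by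
      have e : K a = (p-1) * (p - q) := by
        have : q = 1 / a := by field_simp; linarith
        simp only [K]
        rw [hγinit, ← mul_assoc, hCa, this]
        field_simp
        ring
      rw [e]
      exact mul_neg_of_pos_of_neg (by linarith) (by linarith)
    have hKdiff : DifferentiableOn ℝ K (Set.Ici a) := by
      intro y hy
      have hy0 : y ≠ 0 := (lt_of_lt_of_le ha0 hy).ne'
      have h1 : DifferentiableWithinAt ℝ γ (Set.Ici a) y := hγdiff y hy
      have h2 : DifferentiableWithinAt ℝ (fun x : ℝ => x^(p-2)) (Set.Ici a) y :=
        (Real.differentiableAt_rpow_const_of_ne (p-2) hy0).differentiableWithinAt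
      have h3 : DifferentiableWithinAt ℝ (fun x : ℝ => (p-2) * (1 - γ x) / x) (Set.Ici a) y :=
        DifferentiableWithinAt.div (by fun_prop) (by fun_prop) hy0
      simp only [K]
      fun_prop
    have hKle : K x ≤ 0 := by
      refine image_le_of_deriv_right_lt_deriv_boundary' (f := K) (f' := derivWithin K (Set.Ici a))
        (a := a) (b := x) (B := fun _ => 0) (B' := fun _ => 0)
        (hKdiff.continuousOn.mono Set.Icc_subset_Ici_self) ?_ hKa.le continuousOn_const
        (fun _ _ => hasDerivWithinAt_const _ _ _) ?_ ⟨hx.le, le_rfl⟩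
      · intro y hy
        exact (hKdiff y hy.1).hasDerivWithinAt.mono (Set.Ici_subset_Ici.mpr hy.1)
      · intro y hy hK0
        have hay : a < y := by
          rcases hy.1.eq_or_lt with h | h
          · rw [← h] at hK0; linarith
          · exact h
        have hy0 : 0 < y := ha0.trans hay
        obtain ⟨d, hd⟩ : ∃ d, HasDerivAt γ d y := ⟨_, hγode y hay⟩
        have hd0 := hder0 y d hay hd
        obtain ⟨r1, r2⟩ := rel y d hay hd
        have hK0' : 1 + (p-2) * (1 - γ y) / y
          + C * (y^(p-2) * (1 - γ y)) * ((p-1) * (1 - γ y) - 1) = 0 := hK0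
        rw [hK0', zero_mul] at r1
        have r3 : (p-2) * (1 - γ y) - y * d = 0 := by
          rcases mul_eq_zero.mp r1.symm with h | h
          · exact h
          · linarith
        have hg : HasDerivAt (fun x => 1 - γ x) (-d) y := hd.const_sub 1
        have hpw : HasDerivAt (fun x : ℝ => x^(p-2)) ((p-2) * y^(p-2-1)) y :=
          Real.hasDerivAt_rpow_const (Or.inl hy0.ne')
        have hKd := ((((hg.const_mul (p-2)).div (hasDerivAt_id y) hy0.ne').const_add 1).add
          (((hpw.mul hg).const_mul C).mul ((hg.const_mul (p-1)).sub_const 1)))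
        have hKd' : HasDerivAt K _ y := hKd
        rw [(hKd'.hasDerivWithinAt (s := Set.Ici a)).derivWithin (uniqueDiffOn_Ici a y hay.le)]
        rw [Real.rpow_sub hy0 (p-2) 1, Real.rpow_one]
        have hY : 0 < y^(p-2) := Real.rpow_pos_of_pos hy0 _
        have hgp : 0 < 1 - γ y := by linarith [hγlt y hay.le]
        simp only [id, Pi.mul_apply]
        have z : (p-2) * (y^(p-2) / y) * (1 - γ y) + y^(p-2) * (-d) = 0 := by
          have : (p-2) * (y^(p-2) / y) * (1 - γ y) + y^(p-2) * (-d)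
            = y^(p-2) / y * ((p-2) * (1 - γ y) - y * d) := by field_simp; ring
          rw [this, r3, mul_zero]
        rw [z]
        have t1 : ((p-2) * -d * y - (p-2) * (1 - γ y) * 1) / y^2 < 0 := by
          apply div_neg_of_neg_of_pos _ (by positivity)
          have u1 : 0 ≤ (p-2) * d * y := mul_nonneg (mul_nonneg (by linarith) hd0) hy0.le
          have u2 : 0 < (p-2) * (1 - γ y) := mul_pos (by linarith) hgp
          linarith
        have t2 : 0 ≤ C * (y^(p-2) * (1 - γ y)) * ((p-1) * d) :=
          mul_nonneg (by positivity) (mul_nonneg (by linarith) hd0)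
        linarith
    obtain ⟨r1, r2⟩ := rel x d hx hd
    have hKx : K x * x ≤ 0 := mul_nonpos_of_nonpos_of_nonneg hKle (by linarith)
    have r1' : K x * x = _ := r1
    rw [r1'] at hKx
    by_contra hcon
    have : 0 < (p-2) * (1 - γ x) - x * d := by linarith
    have := mul_pos this r2
    linarith
  intro s hs
  have hhs := hh3 s hs.le
  have hhs0 : 0 < h s := lt_of_lt_of_le ha0 hhs
  by_cases hdf : DifferentiableAt ℝ h s
  · have hlt : a < h s := by
      rcases hhs.eq_or_lt with e | e
      · have := hh2 s hs.le
        rw [← e, hγinit] at this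
        linarith
      · exact e
    obtain ⟨d, hd⟩ : ∃ d, HasDerivAt γ d (h s) := ⟨_, hγode _ hlt⟩
    have hd0 := hder0 _ d hlt hd
    have k := key _ d hlt hd
    have c1 : HasDerivAt (fun y => h y + γ (h y)) (deriv h s + d * deriv h s) s :=
      hdf.hasDerivAt.add (hd.comp s hdf.hasDerivAt)
    have c2 : HasDerivAt (fun y => h y + γ (h y)) 1 s := by
      refine (hasDerivAt_id s).congr_of_eventuallyEq ?_
      filter_upwards [lt_mem_nhds hs] with y hy
      exact hh2 y hy.le
    have e := c1.unique c2
    have hpos : 0 < deriv h s := by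
      by_contra hn
      push Not at hn
      nlinarith
    have es := hh2 s hs.le
    have e3 : h s + 1 - s = 1 - γ (h s) := by linarith
    rw [e3]
    calc _ ≤ deriv h s * (h s + h s * d) := by
          apply mul_le_mul_of_nonneg_left _ hpos.le
          linarith
      _ = h s * (deriv h s + d * deriv h s) := by ring
      _ = h s := by rw [e, mul_one]
  · rw [deriv_zero_of_not_differentiableAt hdf, zero_mul]
    exact hhs0.le
end

section
/- (Choi's inequality, used in the proof of the main theorem.) Fix α ∈ [0,1] and 1 < p < ∞. Let f be a non-negative submartingale and let g be a real-valued adapted integrable process that is α-strongly subordinate to f. Then ‖g‖_p ≤ (p_α* − 1)·‖f‖_p, where p_α* = max{(α+1)p, p/(p−1)}. -/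
open MeasureTheory

lemma choi_quad {q b x r h s : ℝ} (hq : 0 < q) (hb1 : q ≤ b) (hb2 : 1 ≤ b * q)
    (hx : 0 ≤ x) (hr : 0 < r) (hxr : x ≤ r) (hx' : 0 ≤ x + h) (hxr' : x + h ≤ r + s)
    (hs : s ^ 2 ≤ 2 * s * h) :
    (r+s)^(q+1) - (b+1)*(x+h)*(r+s)^q ≤
      r^(q+1) - (b+1)*x*r^q + (-(b+1)*r^q*h + ((q+1)*r^q - (b+1)*q*x*r^(q-1))*s) := by
  set G : ℝ → ℝ := fun t => (r+t*s)^(q+1) - (b+1)*(x+t*h)*(r+t*s)^q with hG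
  set G1 : ℝ → ℝ := fun t => (q+1)*s*(r+t*s)^q -
    (b+1)*(h*(r+t*s)^q + (x+t*h)*(q*s*(r+t*s)^(q-1))) with hG1
  set G2 : ℝ → ℝ := fun t => (q+1)*s*(q*s*(r+t*s)^(q-1)) -
    (b+1)*(h*(q*s*(r+t*s)^(q-1)) +
      (h*(q*s*(r+t*s)^(q-1)) + (x+t*h)*(q*s*((q-1)*s*(r+t*s)^(q-1-1))))) with hG2
  have hRpos : ∀ t : ℝ, 0 ≤ t → t < 1 → 0 < r + t*s := by
    intro t h0 h1
    have : r + t*s = (1-t)*r + t*(r+s) := by ring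
    rw [this]
    have h3 : 0 < (1-t)*r := mul_pos (by linarith) hr
    have h4 : 0 ≤ t*(r+s) := mul_nonneg h0 (by linarith)
    linarith
  have hRd : ∀ t : ℝ, HasDerivAt (fun t : ℝ => r + t*s) s t := by
    intro t
    simpa using ((hasDerivAt_id t).mul_const s).const_add r
  have hXd : ∀ t : ℝ, HasDerivAt (fun t : ℝ => x + t*h) h t := by
    intro t
    simpa using ((hasDerivAt_id t).mul_const h).const_add x
  have hpow : ∀ (a t : ℝ), 0 < r + t*s →
      HasDerivAt (fun t : ℝ => (r+t*s)^a) (a*s*(r+t*s)^(a-1)) t := by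
    intro a t ht
    have := (hRd t).rpow_const (p := a) (Or.inl ht.ne')
    convert this using 1; ring
  have hd1 : ∀ t : ℝ, 0 < r + t*s → HasDerivAt G (G1 t) t := by
    intro t ht
    have h1 := hpow (q+1) t ht
    have h2 := (((hXd t).mul (hpow q t ht)).const_mul (b+1))
    have := h1.sub h2
    rw [add_sub_cancel_right] at this
    refine this.congr_of_eventuallyEq (Filter.Eventually.of_forall fun u => ?_)
    simp [hG]; ring
  have hd2 : ∀ t : ℝ, 0 < r + t*s → HasDerivAt G1 (G2 t) t := by
    intro t ht
    have h1 := (hpow q t ht).const_mul ((q+1)*s)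
    have h2 := (hpow q t ht).const_mul h
    have h3 := (hXd t).mul ((hpow (q-1) t ht).const_mul (q*s))
    exact h1.sub ((h2.add h3).const_mul (b+1))
  have hG2neg : ∀ t : ℝ, 0 ≤ t → t < 1 → G2 t ≤ 0 := by
    intro t h0 h1
    have hR := hRpos t h0 h1
    have hX : 0 ≤ x + t*h := by nlinarith
    have hXR : x + t*h ≤ r + t*s := by nlinarith
    set R := r + t*s
    set X := x + t*h
    have e : R^(q-1) = R^(q-1-1) * R := by
      rw [Real.rpow_sub_one hR.ne' (q-1)]; field_simp
    have hG2e : G2 t = q * R^(q-1-1) * ((q+1)*s^2*R - (b+1)*(2*s*h*R + (q-1)*s^2*X)) := by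
      simp only [hG2]
      change (q+1)*s*(q*s*R^(q-1)) -
        (b+1)*(h*(q*s*R^(q-1)) + (h*(q*s*R^(q-1)) + X*(q*s*((q-1)*s*R^(q-1-1))))) = _
      rw [e]; ring
    rw [hG2e]
    apply mul_nonpos_of_nonneg_of_nonpos
    · have := Real.rpow_pos_of_pos hR (q-1-1); positivity
    · have k1 : 0 ≤ (b+1)*R*(2*s*h - s^2) :=
        mul_nonneg (mul_nonneg (by linarith) hR.le) (by linarith)
      have k2 : 0 ≤ s^2*((b-q)*(R-X)) :=
        mul_nonneg (sq_nonneg _) (mul_nonneg (by linarith) (by linarith))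
      have k3 : 0 ≤ s^2*((b*q-1)*X) :=
        mul_nonneg (sq_nonneg _) (mul_nonneg (by linarith) hX)
      nlinarith
  have hcont : ContinuousOn G (Set.Icc 0 1) := by
    have c1 : Continuous fun t : ℝ => (r+t*s)^(q+1) :=
      Continuous.rpow_const (by fun_prop) (fun _ => Or.inr (by linarith))
    have c2 : Continuous fun t : ℝ => (r+t*s)^q :=
      Continuous.rpow_const (by fun_prop) (fun _ => Or.inr (by linarith))
    have : Continuous G := by simp only [hG]; fun_prop
    exact this.continuousOn
  have hconc : ConcaveOn ℝ (Set.Icc 0 1) G := by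
    refine concaveOn_of_hasDerivWithinAt2_nonpos (convex_Icc 0 1) hcont (f' := G1) (f'' := G2) ?_ ?_ ?_
    · intro t ht; rw [interior_Icc] at ht
      exact (hd1 t (hRpos t ht.1.le ht.2)).hasDerivWithinAt
    · intro t ht; rw [interior_Icc] at ht
      exact (hd2 t (hRpos t ht.1.le ht.2)).hasDerivWithinAt
    · intro t ht; rw [interior_Icc] at ht
      exact hG2neg t ht.1.le ht.2
  have := hconc.slope_le_of_hasDerivAt (x := 0) (y := 1) (by simp) (by simp) (by norm_num)
    (hd1 0 (hRpos 0 le_rfl (by norm_num)))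
  rw [slope_def_field] at this
  simp only [hG, hG1] at this
  norm_num at this
  linarith

lemma choi_bern1 {q : ℝ} (hq : 1 ≤ q) : ((q+1)/q)^q ≤ q+1 := by
  have hq0 : 0 < q := by linarith
  have h1 : (1+q)^((q-1)/q) ≤ 1 + (q-1)/q*q :=
    rpow_one_add_le_one_add_mul_self (by linarith) (div_nonneg (by linarith) hq0.le)
      ((div_le_one hq0).2 (by linarith))
  rw [div_mul_cancel₀ _ hq0.ne', add_sub_cancel] at h1
  have h2 : ((1+q)^((q-1)/q))^q ≤ q^q :=
    Real.rpow_le_rpow (by positivity) h1 hq0.le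
  rw [← Real.rpow_mul (by linarith), div_mul_cancel₀ _ hq0.ne',
    Real.rpow_sub_one (by linarith)] at h2
  rw [Real.div_rpow (by linarith) hq0.le, div_le_iff₀ (by positivity)]
  rw [div_le_iff₀ (by linarith), add_comm 1 q] at h2
  linarith

lemma choi_bern2 {q : ℝ} (hq0 : 0 < q) (hq : q ≤ 1) : q+1 ≤ ((q+1)/q)^q := by
  have hq1 : 0 < 1/q := by positivity
  have h1 : (1+1/q)^(1-q) ≤ 1 + (1-q)*(1/q) :=
    rpow_one_add_le_one_add_mul_self (by linarith) (by linarith) (by linarith)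
  have e : 1 + 1/q = (q+1)/q := by field_simp
  have e2 : 1 + (1-q)*(1/q) = 1/q := by field_simp; ring
  have hpos : 0 < (q+1)/q := by positivity
  rw [e, e2, Real.rpow_sub hpos, Real.rpow_one, div_le_iff₀ (by positivity)] at h1
  have := mul_le_mul_of_nonneg_left h1 hq0.le
  have e3 : q * ((q+1)/q) = q+1 := by field_simp
  have e4 : q * (1/q * ((q+1)/q)^q) = ((q+1)/q)^q := by field_simp
  linarith

lemma choi_aux {φ φ' : ℝ → ℝ} {x0 d : ℝ} (hd : ∀ x, HasDerivAt φ (φ' x) x)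
    (hc : ConvexOn ℝ (Set.Icc 0 1) φ') (h0 : 0 < x0) (h1 : x0 < 1) (hz : φ x0 = 0)
    (hz' : φ' x0 = 0) (hd2 : HasDerivAt φ' d x0) (hdn : 0 ≤ d) (hφ0 : 0 ≤ φ 0) :
    ∀ x, 0 ≤ x → x ≤ 1 → 0 ≤ φ x := by
  intro x hx0 hx1
  by_contra! hneg
  have hcont : Continuous φ := continuous_iff_continuousAt.2 fun x => (hd x).continuousAt
  rcases lt_trichotomy x x0 with hlt | heq | hgt
  · have hx0' : 0 < x := by
      rcases hx0.eq_or_lt with h | h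
      · subst h; linarith
      · exact h
    obtain ⟨a, ha, hae⟩ := exists_hasDerivAt_eq_slope φ φ' hx0' hcont.continuousOn
      (fun x _ => hd x)
    obtain ⟨c, hcm, hce⟩ := exists_hasDerivAt_eq_slope φ φ' hlt hcont.continuousOn
      (fun x _ => hd x)
    have ha' : φ' a < 0 := by rw [hae]; apply div_neg_of_neg_of_pos <;> linarith
    have hc' : 0 < φ' c := by rw [hce]; apply div_pos <;> linarith
    have := hc.le_max_of_mem_Icc (x := a) (y := x0) (z := c)
      ⟨ha.1.le, by linarith [ha.2]⟩ ⟨h0.le, h1.le⟩ ⟨by linarith [ha.2, hcm.1], hcm.2.le⟩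
    rw [hz'] at this
    rw [max_eq_right ha'.le] at this
    linarith
  · rw [heq] at hneg; linarith
  · obtain ⟨c, hcm, hce⟩ := exists_hasDerivAt_eq_slope φ φ' hgt hcont.continuousOn
      (fun x _ => hd x)
    have hc' : φ' c < 0 := by rw [hce]; apply div_neg_of_neg_of_pos <;> linarith
    have := hc.le_slope_of_hasDerivAt (x := x0) (y := c) ⟨h0.le, h1.le⟩
      ⟨by linarith [hcm.1], by linarith [hcm.2]⟩ hcm.1 hd2
    rw [slope_def_field, hz', sub_zero] at this
    have h3 : φ' c / (c - x0) < 0 := div_neg_of_neg_of_pos hc' (by linarith [hcm.1])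
    linarith

lemma choi_refl {F : ℝ → ℝ} (h : ConvexOn ℝ (Set.Icc 0 1) F) :
    ConvexOn ℝ (Set.Icc 0 1) (fun u => F (1-u)) := by
  refine ⟨convex_Icc 0 1, ?_⟩
  intro x hx y hy a b ha hb hab
  have := h.2 (x := 1-x) (y := 1-y) ⟨by linarith [hx.2], by linarith [hx.1]⟩
    ⟨by linarith [hy.2], by linarith [hy.1]⟩ ha hb hab
  have e : 1 - (a • x + b • y) = a • (1-x) + b • (1-y) := by
    simp only [smul_eq_mul]; linear_combination -hab
  simp only [e]; exact this

lemma choi_unit {q b : ℝ} (hq : 0 < q) (hb : 1 ≤ b) (hb1 : q ≤ b) (hb2 : 1 ≤ b * q)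
    {u : ℝ} (hu0 : 0 ≤ u) (hu1 : u ≤ 1) :
    (1-u)^(q+1) - b^(q+1) * u^(q+1) ≤ (q+1)*(b/(b+1))^q*(1-(b+1)*u) := by
  have hb0 : 0 < b := by linarith
  set x0 : ℝ := 1/(b+1) with hx0
  have hx0pos : 0 < x0 := by positivity
  have hx0e : (b+1)*x0 = 1 := by rw [hx0]; field_simp
  have hx1 : 1 - x0 = b*x0 := by linarith
  have hx0lt : x0 < 1 := by nlinarith
  set c : ℝ := (q+1)*(b/(b+1))^q with hc
  have hce : c = (q+1)*(b^q*x0^q) := by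
    rw [hc, ← Real.mul_rpow hb0.le hx0pos.le, hx0]; congr 2; ring
  set φ : ℝ → ℝ := fun u => c*(1-(b+1)*u) - (1-u)^(q+1) + b^(q+1)*u^(q+1) with hφ
  set φ' : ℝ → ℝ := fun u => -c*(b+1) + (q+1)*(1-u)^q + b^(q+1)*((q+1)*u^q) with hφ'
  set φ2 : ℝ → ℝ := fun u => -((q+1)*(q*(1-u)^(q-1))) + b^(q+1)*((q+1)*(q*u^(q-1))) with hφ2
  have hsub : ∀ u : ℝ, HasDerivAt (fun u : ℝ => 1-u) (-1) u := fun u => by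
    simpa using (hasDerivAt_id u).const_sub 1
  have hd : ∀ u, HasDerivAt φ (φ' u) u := by
    intro u
    have h1 := (hsub u).rpow_const (p := q+1) (Or.inr (by linarith))
    have h2 := ((hasDerivAt_id u).rpow_const (p := q+1) (Or.inr (by linarith))).const_mul (b^(q+1))
    have h3 := (((hasDerivAt_id u).const_mul (b+1)).const_sub 1).const_mul c
    have := (h3.sub h1).add h2
    refine this.congr_deriv ?_
    simp [hφ']; ring
  have hd2 : ∀ u, 0 < u → u < 1 → HasDerivAt φ' (φ2 u) u := by
    intro u hu hu'
    have h1 := ((hsub u).rpow_const (p := q) (Or.inl (by simp; linarith))).const_mul (q+1)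
    have h2 := (((hasDerivAt_id u).rpow_const (p := q) (Or.inl (by simp; linarith))).const_mul
      (q+1)).const_mul (b^(q+1))
    have := (h1.const_add (-c*(b+1))).add h2
    refine this.congr_deriv ?_
    simp [hφ2]
  have hz : φ x0 = 0 := by
    simp only [hφ]
    rw [hx0e, hx1, Real.mul_rpow hb0.le hx0pos.le]; ring
  have hz' : φ' x0 = 0 := by
    simp only [hφ']
    rw [hce, hx1, Real.mul_rpow hb0.le hx0pos.le, Real.rpow_add_one hb0.ne']; ring
  have hdn : 0 ≤ φ2 x0 := by
    simp only [hφ2]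
    rw [hx1, Real.mul_rpow hb0.le hx0pos.le]
    have : b^(q-1) ≤ b^(q+1) := Real.rpow_le_rpow_of_exponent_le hb (by linarith)
    have h2 : 0 ≤ (q+1)*q*x0^(q-1) := by positivity
    nlinarith
  have hmain : 0 ≤ φ u := by
    rcases le_total 1 q with h1q | h1q
    · have hpow : ConvexOn ℝ (Set.Icc 0 1) (fun u : ℝ => u^q) :=
        (convexOn_rpow h1q).subset (fun u hu => hu.1) (convex_Icc 0 1)
      have hconv : ConvexOn ℝ (Set.Icc 0 1) φ' := by
        have k1 := (choi_refl hpow).smul (c := q+1) (by linarith)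
        have k2 := (hpow.smul (c := q+1) (by linarith)).smul (c := b^(q+1)) (by positivity)
        have := ((convexOn_const (-c*(b+1)) (convex_Icc (0:ℝ) 1)).add k1).add k2
        exact this
      refine choi_aux hd hconv hx0pos hx0lt hz hz' (hd2 x0 hx0pos hx0lt) hdn ?_ u hu0 hu1
      have : 1 ≤ c := by
        have k1 := choi_bern1 h1q
        have k2 : (q/(q+1))^q ≤ (b/(b+1))^q := by
          apply Real.rpow_le_rpow (by positivity) _ hq.le
          rw [div_le_div_iff₀ (by linarith) (by linarith)]; linarith
        have k3 : 1 ≤ (q+1)*(q/(q+1))^q := by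
          have e : q/(q+1) = ((q+1)/q)⁻¹ := by rw [inv_div]
          rw [e, Real.inv_rpow (by positivity), ← div_eq_mul_inv, le_div_iff₀ (by positivity)]
          linarith
        calc 1 ≤ (q+1)*(q/(q+1))^q := k3
          _ ≤ c := mul_le_mul_of_nonneg_left k2 (by linarith)
      simp only [hφ]
      rw [Real.zero_rpow (by linarith)]
      norm_num; exact this
    · have hpow : ConcaveOn ℝ (Set.Icc 0 1) (fun u : ℝ => u^q) :=
        (Real.concaveOn_rpow hq.le h1q).subset (fun u hu => hu.1) (convex_Icc 0 1)
      have hpown : ConvexOn ℝ (Set.Icc 0 1) (fun u : ℝ => -u^q) := hpow.neg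
      have hconv : ConvexOn ℝ (Set.Icc 0 1) (fun u => - φ' (1-u)) := by
        have k1 := hpown.smul (c := q+1) (by linarith)
        have k2 := ((choi_refl hpown).smul (c := q+1) (by linarith)).smul
          (c := b^(q+1)) (by positivity)
        have := ((convexOn_const (c*(b+1)) (convex_Icc (0:ℝ) 1)).add k1).add k2
        refine this.congr ?_
        intro u _
        simp [hφ']; ring
      have hdr : ∀ u, HasDerivAt (fun u => φ (1-u)) (-φ' (1-u)) u := by
        intro u
        have := (hd (1-u)).comp u (hsub u)
        exact this.congr_deriv (by ring)
      have hd2r : HasDerivAt (fun u => -φ' (1-u)) (φ2 x0) (1-x0) := by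
        have k : HasDerivAt φ' (φ2 x0) (1-(1-x0)) := by
          rw [sub_sub_cancel]; exact hd2 x0 hx0pos hx0lt
        have := (k.comp (1-x0) (hsub (1-x0))).neg
        exact this.congr_deriv (by ring)
      have := choi_aux hdr hconv (x0 := 1-x0) (by linarith) (by linarith)
        (by simp only [sub_sub_cancel]; exact hz) (by simp only [sub_sub_cancel]; rw [hz', neg_zero]) hd2r hdn ?_ (1-u)
        (by linarith) (by linarith)
      · simpa using this
      have k1 := choi_bern2 hq h1q
      have k2 : ((q+1)/q)^q ≤ (b+1)^q := by
        apply Real.rpow_le_rpow (by positivity) _ hq.le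
        rw [div_le_iff₀ hq]; linarith
      have k3 : c ≤ b^q := by
        rw [hc, Real.div_rpow hb0.le (by linarith), ← mul_div_assoc, div_le_iff₀ (by positivity),
          mul_comm]
        exact mul_le_mul_of_nonneg_left (by linarith) (by positivity)
      simp only [hφ, sub_zero, sub_self]
      rw [Real.zero_rpow (by linarith), Real.rpow_add_one hb0.ne', Real.one_rpow]
      nlinarith
  simp only [hφ] at hmain
  linarith

lemma choi_VU {q b : ℝ} (hq : 0 < q) (hb : 1 ≤ b) (hb1 : q ≤ b) (hb2 : 1 ≤ b * q)
    {x y : ℝ} (hx : 0 ≤ x) (hy : 0 ≤ y) :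
    y^(q+1) - b^(q+1) * x^(q+1) ≤
      (q+1)*(b/(b+1))^q*((x+y)^(q+1) - (b+1)*x*(x+y)^q) := by
  rcases (add_nonneg hx hy).eq_or_lt with h | h
  · have hx0 : x = 0 := by linarith
    have hy0 : y = 0 := by linarith
    subst hx0; subst hy0
    simp [Real.zero_rpow (show q+1 ≠ 0 by linarith)]
  · set r := x + y with hr
    have := choi_unit hq hb hb1 hb2 (u := x/r) (by positivity)
      ((div_le_one h).2 (by linarith))
    have e : 1 - x/r = y/r := by field_simp; linarith
    rw [e, Real.div_rpow hy h.le, Real.div_rpow hx h.le] at this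
    have hp : 0 < r^(q+1) := by positivity
    have h2 := mul_le_mul_of_nonneg_right this hp.le
    have e1 : (y^(q+1)/r^(q+1) - b^(q+1)*(x^(q+1)/r^(q+1)))*r^(q+1)
      = y^(q+1) - b^(q+1)*x^(q+1) := by field_simp
    have e2 : (q+1)*(b/(b+1))^q*(1-(b+1)*(x/r))*r^(q+1) =
      (q+1)*(b/(b+1))^q*(r^(q+1) - (b+1)*x*r^q) := by
      rw [Real.rpow_add_one h.ne']; field_simp
    linarith

noncomputable def choiU (q b x y : ℝ) : ℝ := (x+|y|)^(q+1) - (b+1)*x*(x+|y|)^q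
noncomputable def choiB (q b x y : ℝ) : ℝ :=
  (q+1)*(x+|y|)^q - (b+1)*q*x*(x+|y|)^(q-1)
noncomputable def choiA (q b x y : ℝ) : ℝ := -(b+1)*(x+|y|)^q + choiB q b x y
noncomputable def choiC (q b x y : ℝ) : ℝ := (if 0 ≤ y then 1 else -1) * choiB q b x y

set_option maxHeartbeats 1000000 in
lemma choi_step_nonneg {q b x y h k : ℝ} (hq : 0 < q) (hb : 1 ≤ b) (hb1 : q ≤ b)
    (hb2 : 1 ≤ b * q) (hx : 0 ≤ x) (hy : 0 ≤ y) (hx' : 0 ≤ x + h) (hk : |k| ≤ |h|) :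
    choiU q b (x+h) (y+k) ≤ choiU q b x y + (choiA q b x y * h + choiB q b x y * k) := by
  have hk2 : k^2 ≤ h^2 := sq_le_sq.2 hk
  unfold choiA
  unfold choiU choiB
  rw [abs_of_nonneg hy]
  rcases (add_nonneg hx hy).eq_or_lt with hr | hr
  · have hx0 : x = 0 := by linarith
    have hy0 : y = 0 := by linarith
    subst hx0; subst hy0
    simp only [zero_add, mul_zero, zero_mul, sub_zero] at *
    rw [Real.zero_rpow (by linarith), Real.zero_rpow (by linarith)]
    rcases (show 0 ≤ h + |k| by positivity).eq_or_lt with h0 | h0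
    · rw [← h0, Real.zero_rpow (by linarith), Real.zero_rpow (by linarith)]; simp
    · rw [Real.rpow_add_one h0.ne']
      rw [abs_of_nonneg hx'] at hk
      have : 0 < (h+|k|)^q := by positivity
      have h3 : h ≤ b*h := by nlinarith
      nlinarith [mul_nonneg this.le (show 0 ≤ b*h - |k| by linarith)]
  rcases le_or_gt 0 (y+k) with hyk | hyk
  · rw [abs_of_nonneg hyk]
    have := choi_quad (s := h+k) hq hb1 hb2 hx hr (by linarith) hx' (by linarith)
      (by nlinarith)
    have e : x + h + (y + k) = x + y + (h+k) := by ring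
    rw [e]; linarith
  · rw [abs_of_neg hyk]
    have hkn : k < 0 := by linarith
    set θ := y/(-k) with hθ
    have hθk : θ*k = -y := by rw [hθ, div_neg, neg_mul, div_mul_cancel₀ _ hkn.ne]
    have hθ0 : 0 ≤ θ := div_nonneg hy (by linarith)
    have hθ1 : θ < 1 := by rw [hθ, div_lt_one (by linarith)]; linarith
    have hh0 : h ≠ 0 := by
      rintro rfl
      nlinarith
    have hx1 : 0 < x + θ*h := by
      have e : x + θ*h = (1-θ)*x + θ*(x+h) := by ring
      rw [e]
      rcases hx.eq_or_lt with h0 | h0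
      · subst h0
        have hy0 : 0 < y := by linarith
        have : 0 < θ := div_pos hy0 (by linarith)
        have hhp : 0 < h := lt_of_le_of_ne (by linarith) hh0.symm
        rw [mul_zero, zero_add, zero_add]; positivity
      · have := mul_pos (sub_pos.2 hθ1) h0
        have := mul_nonneg hθ0 hx'
        linarith
    set x1 := x + θ*h with hx1def
    have hs0 : (h+k)^2 ≤ 2*(h+k)*h := by nlinarith
    have hs0' : (h-k)^2 ≤ 2*(h-k)*h := by nlinarith
    have a := choi_quad (s := θ*(h+k)) (h := θ*h) hq hb1 hb2 hx hr (by linarith) (by linarith)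
      (by nlinarith) (by nlinarith [mul_nonneg (sq_nonneg θ) (sub_nonneg.2 hs0)])
    have bb := choi_quad (x := x1) (r := x1) (s := -(θ*(h+k))) (h := -(θ*h)) hq hb1 hb2 hx1.le hx1
      le_rfl (by linarith) (by nlinarith)
      (by nlinarith [mul_nonneg (sq_nonneg θ) (sub_nonneg.2 hs0)])
    have cc := choi_quad (x := x1) (r := x1) (s := (1-θ)*(h-k)) (h := (1-θ)*h) hq hb1 hb2 hx1.le
      hx1 le_rfl (by linarith) (by nlinarith)
      (by nlinarith [mul_nonneg (sq_nonneg (1-θ)) (sub_nonneg.2 hs0')])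
    have e1 : x + y + θ*(h+k) = x1 := by rw [hx1def]; linarith
    have e2 : x + θ*h = x1 := rfl
    have e3 : x1 + -(θ*(h+k)) = x + y := by linarith
    have e4 : x1 + -(θ*h) = x := by linarith
    have e5 : x1 + (1-θ)*(h-k) = x + h + -(y+k) := by linarith
    have e6 : x1 + (1-θ)*h = x + h := by linarith
    rw [e1, e2] at a
    rw [e3, e4] at bb
    rw [e5, e6] at cc
    have e7 : x1 * x1^(q-1) = x1^q := by rw [Real.rpow_sub_one hx1.ne']; field_simp
    have hB1 : (q+1)*x1^q - (b+1)*q*x1*x1^(q-1) = (1-b*q)*x1^q := by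
      linear_combination -(b+1)*q*e7
    rw [hB1] at bb cc
    set D0 := -(b+1)*(x+y)^q*h + ((q+1)*(x+y)^q - (b+1)*q*x*(x+y)^(q-1))*(h+k) with hD0
    set D1 := -(b+1)*x1^q*h + (1-b*q)*x1^q*(h+k) with hD1
    have hkk : 0 ≤ (1-b*q)*x1^q*k :=
      mul_nonneg_of_nonpos_of_nonpos (mul_nonpos_of_nonpos_of_nonneg (by linarith)
        (by positivity)) hkn.le
    have ga : x1^(q+1) - (b+1)*x1*x1^q ≤ (x+y)^(q+1) - (b+1)*x*(x+y)^q + θ*D0 := by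
      rw [hD0]; linarith
    have gb : (x+y)^(q+1) - (b+1)*x*(x+y)^q ≤ x1^(q+1) - (b+1)*x1*x1^q - θ*D1 := by
      rw [hD1]; linarith
    have gc : (x + h + -(y+k))^(q+1) - (b+1)*(x+h)*(x + h + -(y+k))^q ≤
        x1^(q+1) - (b+1)*x1*x1^q + (1-θ)*D1 := by
      have m := mul_nonneg (sub_nonneg.2 hθ1.le) hkk
      rw [hD1]; linarith
    have gd : D1 ≤ D0 := by
      rcases hθ0.eq_or_lt with h0 | h0
      · have hy0 : y = 0 := by rw [← h0] at hθk; linarith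
        have hxx : x1 = x := by rw [hx1def, ← h0]; ring
        rw [hD0, hD1, hy0, add_zero, hxx]
        rw [hxx] at hB1
        rw [hB1]
      · have : 0 ≤ θ*(D0-D1) := by linarith
        have := nonneg_of_mul_nonneg_right this h0
        linarith
    have ge := mul_le_mul_of_nonneg_left gd (sub_nonneg.2 hθ1.le)
    calc _ ≤ (x+y)^(q+1) - (b+1)*x*(x+y)^q + D0 := by linarith
      _ = _ := by rw [hD0]; ring

lemma choi_step {q b x y h k : ℝ} (hq : 0 < q) (hb : 1 ≤ b) (hb1 : q ≤ b)
    (hb2 : 1 ≤ b * q) (hx : 0 ≤ x) (hx' : 0 ≤ x + h) (hk : |k| ≤ |h|) :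
    choiU q b (x+h) (y+k) ≤ choiU q b x y + (choiA q b x y * h + choiC q b x y * k) := by
  rcases le_or_gt 0 y with hy | hy
  · have := choi_step_nonneg hq hb hb1 hb2 hx hy hx' hk
    simpa [choiC, hy] using this
  · have := choi_step_nonneg (y := -y) (k := -k) hq hb hb1 hb2 hx (by linarith) hx'
      (by rwa [abs_neg])
    have e : -y + -k = -(y+k) := by ring
    rw [e] at this
    simp only [choiU, choiA, choiB, choiC, abs_neg, not_le.2 hy, if_false] at this ⊢
    linarith

lemma choi_xr {q x r : ℝ} (hq : 0 < q) (hx : 0 ≤ x) (hxr : x ≤ r) : x * r^(q-1) ≤ r^q := by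
  rcases hx.eq_or_lt with h | h
  · subst h; rw [zero_mul]; positivity
  · have hr : 0 < r := by linarith
    rw [Real.rpow_sub_one hr.ne', ← mul_div_assoc, div_le_iff₀ hr, mul_comm]
    exact mul_le_mul_of_nonneg_left hxr (by positivity)

lemma choi_AB {q b x y α : ℝ} (hq : 0 < q) (hb : 1 ≤ b) (hb1 : (α+1)*(q+1) ≤ b+1)
    (hb2 : 1 ≤ b * q) (hα0 : 0 ≤ α) (hα1 : α ≤ 1) (hx : 0 ≤ x) :
    choiA q b x y + α * |choiC q b x y| ≤ 0 := by
  have hC : |choiC q b x y| = |choiB q b x y| := by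
    unfold choiC; split_ifs <;> simp
  rw [hC]; unfold choiA choiB
  have hy := abs_nonneg y
  rcases (add_nonneg hx hy).eq_or_lt with hr | hr
  · have hx0 : x = 0 := by linarith
    rw [← hr, hx0, Real.zero_rpow hq.ne']; simp
  · set r := x + |y| with hrdef
    have e : r^q = r^(q-1) * r := by rw [Real.rpow_sub_one hr.ne']; field_simp
    have hP : 0 < r^(q-1) := by positivity
    set P := r^(q-1)
    rw [e]
    have e2 : (q+1)*(P*r) - (b+1)*q*x*P = P*((q+1)*r - (b+1)*q*x) := by ring
    rw [e2, abs_mul, abs_of_pos hP]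
    have e3 : -(b+1)*(P*r) + P*((q+1)*r - (b+1)*q*x) + α*(P*|(q+1)*r - (b+1)*q*x|)
      = P*(-(b+1)*r + ((q+1)*r - (b+1)*q*x) + α*|(q+1)*r - (b+1)*q*x|) := by ring
    rw [e3]
    apply mul_nonpos_of_nonneg_of_nonpos hP.le
    have hxr : x ≤ r := by linarith
    have k0 : 0 ≤ (b+1)*q*x := by positivity
    rcases abs_cases ((q+1)*r - (b+1)*q*x) with ⟨h1, _⟩ | ⟨h1, _⟩ <;> rw [h1]
    · nlinarith [mul_nonneg (sub_nonneg.2 hb1) hr.le, mul_nonneg hα0 k0]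
    · nlinarith [mul_nonneg (sub_nonneg.2 hb1) hr.le, mul_nonneg (sub_nonneg.2 hα1) k0,
        mul_nonneg hα0 (mul_nonneg (show (0:ℝ) ≤ q+1 by linarith) hr.le)]

lemma choi_U_bound {q b x y : ℝ} (hq : 0 < q) (hb : 1 ≤ b) (hx : 0 ≤ x) :
    |choiU q b x y| ≤ (b+2)*(x+|y|)^(q+1) := by
  have hy := abs_nonneg y
  unfold choiU
  set r := x + |y|
  have hr : 0 ≤ r := by positivity
  have e : r^(q+1) = r^q*r := by
    rw [Real.rpow_add' hr (by linarith), Real.rpow_one]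
  have h1 : 0 ≤ x * r^q := by positivity
  have h2 : x * r^q ≤ r^(q+1) := by
    rw [e, mul_comm]; exact mul_le_mul_of_nonneg_left (by simp [r]) (by positivity)
  have h3 : 0 ≤ r^(q+1) := by positivity
  rw [abs_le]; constructor <;> nlinarith

lemma choi_B_bound {q b x y : ℝ} (hq : 0 < q) (hb : 1 ≤ b) (hx : 0 ≤ x) :
    |choiB q b x y| ≤ ((q+1)+(b+1)*q)*(x+|y|)^q := by
  have hy := abs_nonneg y
  unfold choiB
  have h := choi_xr hq hx (show x ≤ x+|y| by linarith)
  set r := x + |y|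
  have hr : 0 ≤ r := by positivity
  have h1 : 0 ≤ (b+1)*q*(x * r^(q-1)) := by positivity
  have h2 : (b+1)*q*(x * r^(q-1)) ≤ (b+1)*q*r^q :=
    mul_le_mul_of_nonneg_left h (by positivity)
  have h3 : 0 ≤ (q+1)*r^q := by positivity
  rw [abs_le]; constructor <;> nlinarith

lemma choi_C_bound {q b x y : ℝ} (hq : 0 < q) (hb : 1 ≤ b) (hx : 0 ≤ x) :
    |choiC q b x y| ≤ ((q+1)+(b+1)*q+(b+1))*(x+|y|)^q := by
  have hC : |choiC q b x y| = |choiB q b x y| := by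
    unfold choiC; split_ifs <;> simp
  rw [hC]
  have := choi_B_bound (y := y) hq hb hx
  have : 0 ≤ (b+1)*(x+|y|)^q := by positivity
  linarith

lemma choi_A_bound {q b x y : ℝ} (hq : 0 < q) (hb : 1 ≤ b) (hx : 0 ≤ x) :
    |choiA q b x y| ≤ ((q+1)+(b+1)*q+(b+1))*(x+|y|)^q := by
  unfold choiA
  have h1 := choi_B_bound (y := y) hq hb hx
  have h2 : 0 ≤ (b+1)*(x+|y|)^q := by positivity
  have h3 := abs_le.1 h1
  rw [abs_le]; constructor <;> nlinarith

lemma choi_meas (q b : ℝ) :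
    Measurable (fun z : ℝ × ℝ => choiU q b z.1 z.2) ∧
    Measurable (fun z : ℝ × ℝ => choiA q b z.1 z.2) ∧
    Measurable (fun z : ℝ × ℝ => choiC q b z.1 z.2) := by
  have hr : ∀ a : ℝ, Measurable (fun z : ℝ × ℝ => (z.1 + |z.2|)^a) := by
    intro a
    exact (measurable_fst.add measurable_snd.abs).pow_const a
  have h1 := hr (q+1)
  have h2 := hr q
  have h3 := hr (q-1)
  have hB : Measurable (fun z : ℝ × ℝ => choiB q b z.1 z.2) := by
    unfold choiB; fun_prop
  refine ⟨by unfold choiU; fun_prop, by unfold choiA; fun_prop, ?_⟩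
  unfold choiC
  refine Measurable.mul ?_ hB
  exact Measurable.ite (measurableSet_le measurable_const measurable_snd) measurable_const
    measurable_const

lemma choi_prod_bound {q K r r' a h : ℝ} (hq : 0 < q) (hK : 0 ≤ K) (hr : 0 ≤ r) (hr' : 0 ≤ r')
    (ha : |a| ≤ K * r^q) (hh : |h| ≤ r + r') : |a * h| ≤ K * (r+r')^(q+1) := by
  have h1 : r^q ≤ (r+r')^q := Real.rpow_le_rpow hr (by linarith) hq.le
  have e : (r+r')^(q+1) = (r+r')^q*(r+r') := by
    rw [Real.rpow_add' (by linarith) (by linarith), Real.rpow_one]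
  rw [abs_mul, e, ← mul_assoc]
  exact mul_le_mul (ha.trans (mul_le_mul_of_nonneg_left h1 hK)) hh (abs_nonneg _) (by positivity)

/-- Choi's inequality: if `f` is a non-negative submartingale and `g` is `α`-strongly
subordinate to `f`, `α ∈ [0,1]`, then `‖g‖_p ≤ (p_α* - 1) ‖f‖_p` for `1 < p < ∞`,
where `p_α* = max {(α+1)p, p/(p-1)}`. -/
theorem choi_inequality
    {Ω : Type*} {m0 : MeasurableSpace Ω} {μ : Measure Ω} [IsProbabilityMeasure μ]
    {𝓕 : Filtration ℕ m0} {f g : ℕ → Ω → ℝ} {α p : ℝ}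
    (hα0 : 0 ≤ α) (hα1 : α ≤ 1) (hp : 1 < p)
    (hf : Submartingale f 𝓕 μ) (hf0 : ∀ n : ℕ, 0 ≤ᵐ[μ] f n)
    (hgadp : Adapted 𝓕 g) (hgint : ∀ n : ℕ, Integrable (g n) μ)
    (hsub0 : ∀ᵐ ω ∂μ, |g 0 ω| ≤ |f 0 ω|)
    (hsub : ∀ n : ℕ, ∀ᵐ ω ∂μ, |g (n+1) ω - g n ω| ≤ |f (n+1) ω - f n ω|)
    (hcond : ∀ n : ℕ, ∀ᵐ ω ∂μ,
      |(μ[g (n+1) - g n | 𝓕 n]) ω| ≤ α * (μ[f (n+1) - f n | 𝓕 n]) ω) :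
    (⨆ n : ℕ, eLpNorm (g n) (ENNReal.ofReal p) μ)
      ≤ ENNReal.ofReal (max ((α+1)*p) (p/(p-1)) - 1)
        * ⨆ n : ℕ, eLpNorm (f n) (ENNReal.ofReal p) μ := by
  
  obtain ⟨q, rfl⟩ : ∃ q, p = q + 1 := ⟨p - 1, by ring⟩
  have hq : 0 < q := by linarith
  rw [add_sub_cancel_right]
  set b : ℝ := max ((α+1)*(q+1)) ((q+1)/q) - 1 with hbdef
  have hbα : (α+1)*(q+1) ≤ b+1 := by
    rw [hbdef, sub_add_cancel]; exact le_max_left _ _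
  have hbq : (q+1)/q ≤ b+1 := by
    rw [hbdef, sub_add_cancel]; exact le_max_right _ _
  have hb1 : q ≤ b := by nlinarith
  have hb2 : 1 ≤ b * q := by
    rw [div_le_iff₀ hq] at hbq; linarith
  have hb : 1 ≤ b := by
    by_contra! h
    nlinarith
  have hb0 : 0 < b := by linarith
  clear_value b
  set P : ENNReal := ENNReal.ofReal (q+1) with hP
  have hPr : P.toReal = q+1 := ENNReal.toReal_ofReal (by linarith)
  have hP0 : P ≠ 0 := by rw [hP]; simp; linarith
  have hPt : P ≠ ⊤ := ENNReal.ofReal_ne_top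
  by_cases hS : (⨆ n : ℕ, eLpNorm (f n) P μ) = ⊤
  · rw [hS, ENNReal.mul_top]
    · exact le_top
    · simpa using hb0
  have hfm : ∀ n, Measurable[𝓕 n] (f n) := fun n => (hf.stronglyAdapted n).measurable
  have hgm : ∀ n, Measurable[𝓕 n] (g n) := fun n => hgadp n
  have hfi : ∀ n, Integrable (f n) μ := hf.integrable
  have hfL : ∀ n, MemLp (f n) P μ := fun n =>
    ⟨(hfi n).aestronglyMeasurable,
      lt_of_le_of_lt (le_iSup (fun n => eLpNorm (f n) P μ) n) (lt_top_iff_ne_top.2 hS)⟩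
  have hgL : ∀ n, MemLp (g n) P μ := by
    intro n
    induction n with
    | zero =>
      refine (hfL 0).mono (hgint 0).aestronglyMeasurable ?_
      simpa [Real.norm_eq_abs] using hsub0
    | succ n ih =>
      have h1 : MemLp (g (n+1) - g n) P μ := by
        refine ((hfL (n+1)).sub (hfL n)).mono
          ((hgint (n+1)).sub (hgint n)).aestronglyMeasurable ?_
        simpa [Real.norm_eq_abs] using hsub n
      have := ih.add h1
      simpa using this
  -- the radius process
  set R : ℕ → Ω → ℝ := fun n ω => |f n ω| + |g n ω| with hR
  have hRL : ∀ n, MemLp (R n) P μ := fun n => (hfL n).norm.add (hgL n).norm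
  have hR0 : ∀ n ω, 0 ≤ R n ω := fun n ω => by simp only [hR]; positivity
  have hRe : ∀ n, ∀ᵐ ω ∂μ, f n ω + |g n ω| = R n ω := by
    intro n
    filter_upwards [hf0 n] with ω h
    simp only [hR]; rw [abs_of_nonneg (by simpa using h : 0 ≤ f n ω)]
  have hint_rpow : ∀ T : Ω → ℝ, (∀ ω, 0 ≤ T ω) → MemLp T P μ →
      Integrable (fun ω => T ω ^ (q+1)) μ := by
    intro T hT0 hT
    have := hT.integrable_norm_rpow hP0 hPt
    rw [hPr] at this
    simpa [Real.norm_eq_abs, abs_of_nonneg (hT0 _)] using this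
  obtain ⟨mU, mA, mC⟩ := choi_meas q b
  have hpair : ∀ n, Measurable[𝓕 n] (fun ω => (f n ω, g n ω)) := fun n =>
    (hfm n).prodMk (hgm n)
  have hUi : ∀ n, Integrable (fun ω => choiU q b (f n ω) (g n ω)) μ := by
    intro n
    refine ((hint_rpow _ (hR0 n) (hRL n)).const_mul (b+2)).mono' ?_ ?_
    · exact ((mU.comp (hpair n)).mono (𝓕.le n) le_rfl).aestronglyMeasurable
    · filter_upwards [hf0 n, hRe n] with ω h0 he
      have := choi_U_bound (y := g n ω) hq hb (by simpa using h0 : 0 ≤ f n ω)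
      rwa [he] at this
  set K : ℝ := (q+1)+(b+1)*q+(b+1) with hK
  have hK0 : 0 ≤ K := by positivity
  have hdom : ∀ (n : ℕ) (a h : Ω → ℝ), AEStronglyMeasurable a μ → AEStronglyMeasurable h μ →
      (∀ᵐ ω ∂μ, |a ω| ≤ K * (R n ω)^q) → (∀ᵐ ω ∂μ, |h ω| ≤ R n ω + R (n+1) ω) →
      Integrable (a * h) μ := by
    intro n a h ha hh hab hhb
    refine ((hint_rpow (fun ω => R n ω + R (n+1) ω)
      (fun ω => add_nonneg (hR0 _ _) (hR0 _ _)) ((hRL n).add (hRL (n+1)))).const_mul K).mono'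
        (ha.mul hh) ?_
    filter_upwards [hab, hhb] with ω h1 h2
    exact choi_prod_bound hq hK0 (hR0 _ _) (hR0 _ _) h1 h2
  have hmono : ∀ n, ∫ ω, choiU q b (f (n+1) ω) (g (n+1) ω) ∂μ ≤
      ∫ ω, choiU q b (f n ω) (g n ω) ∂μ := by
    intro n
    set A : Ω → ℝ := fun ω => choiA q b (f n ω) (g n ω) with hA
    set C : Ω → ℝ := fun ω => choiC q b (f n ω) (g n ω) with hC
    have hAm : StronglyMeasurable[𝓕 n] A := (mA.comp (hpair n)).stronglyMeasurable
    have hCm : StronglyMeasurable[𝓕 n] C := (mC.comp (hpair n)).stronglyMeasurable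
    have hdf : Integrable (f (n+1) - f n) μ := (hfi _).sub (hfi _)
    have hdg : Integrable (g (n+1) - g n) μ := (hgint _).sub (hgint _)
    have hdfR : ∀ ω, |f (n+1) ω - f n ω| ≤ R n ω + R (n+1) ω := by
      intro ω
      have := abs_sub (f (n+1) ω) (f n ω)
      simp only [hR]
      linarith [abs_nonneg (g n ω), abs_nonneg (g (n+1) ω)]
    have iA : Integrable (A * (f (n+1) - f n)) μ := by
      refine hdom n _ _ (hAm.mono (𝓕.le n)).aestronglyMeasurable hdf.aestronglyMeasurable ?_
        (Filter.Eventually.of_forall hdfR)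
      filter_upwards [hf0 n, hRe n] with ω h0 he
      rw [← he]
      exact choi_A_bound hq hb (by simpa using h0)
    have iC : Integrable (C * (g (n+1) - g n)) μ := by
      refine hdom n _ _ (hCm.mono (𝓕.le n)).aestronglyMeasurable hdg.aestronglyMeasurable ?_ ?_
      · filter_upwards [hf0 n, hRe n] with ω h0 he
        rw [← he]
        exact choi_C_bound hq hb (by simpa using h0)
      · filter_upwards [hsub n] with ω h
        exact h.trans (hdfR ω)
    have pA := condExp_mul_of_stronglyMeasurable_left hAm iA hdf
    have pC := condExp_mul_of_stronglyMeasurable_left hCm iC hdg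
    have eA : ∫ ω, (A * (f (n+1) - f n)) ω ∂μ = ∫ ω, (A * μ[f (n+1) - f n | 𝓕 n]) ω ∂μ := by
      rw [← integral_condExp (𝓕.le n)]; exact integral_congr_ae pA
    have eC : ∫ ω, (C * (g (n+1) - g n)) ω ∂μ = ∫ ω, (C * μ[g (n+1) - g n | 𝓕 n]) ω ∂μ := by
      rw [← integral_condExp (𝓕.le n)]; exact integral_congr_ae pC
    have iA' : Integrable (A * μ[f (n+1) - f n | 𝓕 n]) μ := integrable_condExp.congr pA
    have iC' : Integrable (C * μ[g (n+1) - g n | 𝓕 n]) μ := integrable_condExp.congr pC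
    have hneg : ∫ ω, (A * μ[f (n+1) - f n | 𝓕 n]) ω ∂μ +
        ∫ ω, (C * μ[g (n+1) - g n | 𝓕 n]) ω ∂μ ≤ 0 := by
      rw [← integral_add iA' iC']
      apply integral_nonpos_of_ae
      filter_upwards [hf0 n, hcond n, hf.condExp_sub_nonneg n.le_succ] with ω h0 h1 h2
      simp only [Pi.mul_apply, Pi.zero_apply] at h2 ⊢
      have k1 := choi_AB (y := g n ω) hq hb hbα hb2 hα0 hα1 (by simpa using h0 : 0 ≤ f n ω)
      change A ω + α * |C ω| ≤ 0 at k1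
      change 0 ≤ (μ[f (n+1) - f n | 𝓕 n]) ω at h2
      have k2 : C ω * (μ[g (n+1) - g n | 𝓕 n]) ω ≤ |C ω| * (α * (μ[f (n+1) - f n | 𝓕 n]) ω) := by
        refine (le_abs_self _).trans ?_
        rw [abs_mul]
        exact mul_le_mul_of_nonneg_left h1 (abs_nonneg _)
      have k3 := mul_nonpos_of_nonpos_of_nonneg k1 h2
      linarith
    have hstep : ∫ ω, choiU q b (f (n+1) ω) (g (n+1) ω) ∂μ ≤
        ∫ ω, (choiU q b (f n ω) (g n ω) +
          ((A * (f (n+1) - f n)) ω + (C * (g (n+1) - g n)) ω)) ∂μ := by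
      refine integral_mono_ae (hUi _) ((hUi n).add (iA.add iC)) ?_
      filter_upwards [hf0 n, hf0 (n+1), hsub n] with ω h0 h1 h2
      have := choi_step (x := f n ω) (y := g n ω) (h := f (n+1) ω - f n ω)
        (k := g (n+1) ω - g n ω) hq hb hb1 hb2 (by simpa using h0) (by simpa using h1) h2
      simpa [hA, hC] using this
    have e1 : ∫ ω, (choiU q b (f n ω) (g n ω) +
          ((A * (f (n+1) - f n)) ω + (C * (g (n+1) - g n)) ω)) ∂μ =
        ∫ ω, choiU q b (f n ω) (g n ω) ∂μ + (∫ ω, (A * (f (n+1) - f n)) ω ∂μ +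
          ∫ ω, (C * (g (n+1) - g n)) ω ∂μ) := by
      rw [← integral_add iA iC]
      exact integral_add (hUi n) (iA.add iC)
    rw [e1, eA, eC] at hstep
    linarith
  have hUneg : ∀ n, ∫ ω, choiU q b (f n ω) (g n ω) ∂μ ≤ 0 := by
    intro n
    induction n with
    | zero =>
      apply integral_nonpos_of_ae
      filter_upwards [hf0 0, hsub0] with ω h0 h1
      have h0' : 0 ≤ f 0 ω := by simpa using h0
      rw [abs_of_nonneg h0'] at h1
      have hr : 0 ≤ f 0 ω + |g 0 ω| := by positivity
      simp only [choiU, Pi.zero_apply]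
      rw [Real.rpow_add' hr (by linarith), Real.rpow_one]
      have h3 : f 0 ω ≤ b * f 0 ω := by nlinarith
      have h4 : 0 ≤ (f 0 ω + |g 0 ω|)^q := by positivity
      nlinarith [mul_nonneg h4 (show 0 ≤ b * f 0 ω - |g 0 ω| by linarith)]
    | succ n ih => exact (hmono n).trans ih
  have hfin : ∀ n, eLpNorm (g n) P μ ≤ ENNReal.ofReal b * eLpNorm (f n) P μ := by
    intro n
    rw [(hgL n).eLpNorm_eq_integral_rpow_norm hP0 hPt,
      (hfL n).eLpNorm_eq_integral_rpow_norm hP0 hPt, hPr, ← ENNReal.ofReal_mul hb0.le]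
    apply ENNReal.ofReal_le_ofReal
    have iF : Integrable (fun ω => ‖f n ω‖ ^ (q+1)) μ :=
      hint_rpow _ (fun ω => norm_nonneg _) (hfL n).norm
    have iG : Integrable (fun ω => ‖g n ω‖ ^ (q+1)) μ :=
      hint_rpow _ (fun ω => norm_nonneg _) (hgL n).norm
    have h1 : ∫ ω, (‖g n ω‖ ^ (q+1) - b^(q+1) * ‖f n ω‖ ^ (q+1)) ∂μ ≤
        ∫ ω, (q+1)*(b/(b+1))^q * choiU q b (f n ω) (g n ω) ∂μ := by
      refine integral_mono_ae (iG.sub (iF.const_mul _)) ((hUi n).const_mul _) ?_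
      filter_upwards [hf0 n] with ω h0
      have h0' : 0 ≤ f n ω := by simpa using h0
      have := choi_VU hq hb hb1 hb2 h0' (abs_nonneg (g n ω))
      simp only [Real.norm_eq_abs]
      rw [abs_of_nonneg h0']
      exact this
    rw [integral_sub iG (iF.const_mul _), integral_const_mul, integral_const_mul] at h1
    have h2 : (q+1)*(b/(b+1))^q * ∫ ω, choiU q b (f n ω) (g n ω) ∂μ ≤ 0 :=
      mul_nonpos_of_nonneg_of_nonpos (by positivity) (hUneg n)
    have hF0 : 0 ≤ ∫ ω, ‖f n ω‖ ^ (q+1) ∂μ := integral_nonneg fun ω => by positivity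
    have hG0 : 0 ≤ ∫ ω, ‖g n ω‖ ^ (q+1) ∂μ := integral_nonneg fun ω => by positivity
    calc (∫ ω, ‖g n ω‖ ^ (q+1) ∂μ) ^ (q+1)⁻¹
        ≤ (b^(q+1) * ∫ ω, ‖f n ω‖ ^ (q+1) ∂μ) ^ (q+1)⁻¹ :=
          Real.rpow_le_rpow hG0 (by linarith) (by positivity)
      _ = b * (∫ ω, ‖f n ω‖ ^ (q+1) ∂μ) ^ (q+1)⁻¹ := by
          rw [Real.mul_rpow (by positivity) hF0, Real.rpow_rpow_inv hb0.le (by linarith)]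
  refine iSup_le fun n => (hfin n).trans ?_
  gcongr
  exact le_iSup (fun n => eLpNorm (f n) P μ) n
end
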